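/- Let A be an abelian category of global dimension ≤ n (i.e., Ext^{n+1}_A(X, Y) = 0 for all objects X, Y), and let C be a (cochain) complex of objects of A such that H^i(C) = 0 whenever n does not divide i. Then C is quasi-isomorphic to the complex ⊕_i H^{ni}(C)[−ni] (the complex with the object H^{ni}(C) placed in degree ni for each i and zero differentials). -/

import Mathlib

open CategoryTheory CategoryTheory.Limits ZeroObject

universe w v u

namespace Rouquier

variable {A : Type u} [Category.{v} A] [Abelian A]

/-- The complex `⊕_i H^{ni}(C)[-ni]` : its component in degree `m` is `H^m(C)` if
`n ∣ m` and `0` otherwise, and its differentials are zero. -/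
noncomputable def splitComplex (C : CochainComplex A ℤ) (n : ℕ) : CochainComplex A ℤ where
  X m := if (n : ℤ) ∣ m then C.homology m else 0
  d _ _ := 0
  shape _ _ _ := rfl
  d_comp_d' _ _ _ _ _ := by simp

open HomologicalComplex in
theorem quasiIsoAt_of_pOpcycles_comp_eq {K L : CochainComplex A ℤ} {i : ℤ} (f : K ⟶ L)
    (hK : ∀ j, K.d i j = 0) (hL : ∀ j, L.d i j = 0) (hL' : ∀ j, L.d j i = 0)
    (g : K.opcycles i ⟶ L.X i) [IsIso g] (hg : f.f i = K.pOpcycles i ≫ g) :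
    QuasiIsoAt f i := by
  have h₁ : IsIso (K.homologyι i) := K.isIso_homologyι i _ rfl (hK _)
  have h₂ : IsIso (L.homologyι i) := L.isIso_homologyι i _ rfl (hL _)
  have h₃ : IsIso (L.pOpcycles i) := L.isIso_pOpcycles _ i rfl (hL' _)
  have h₄ : opcyclesMap f i = g ≫ L.pOpcycles i := by
    rw [← cancel_epi (K.pOpcycles i), p_opcyclesMap, hg, Category.assoc]
  have h₅ : homologyMap f i = K.homologyι i ≫ g ≫ L.pOpcycles i ≫ inv (L.homologyι i) := by
    rw [← cancel_mono (L.homologyι i), homologyι_naturality, h₄]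
    simp
  rw [quasiIsoAt_iff_isIso_homologyMap, h₅]
  infer_instance

open HomologicalComplex in
theorem exists_epi_quasiIsoAt_of_isStrictlyLE (K L : CochainComplex A ℤ) (i : ℤ)
    [K.IsStrictlyLE i] (hL : ∀ j, L.d i j = 0) (hL' : ∀ j, L.d j i = 0)
    (e : K.homology i ≅ L.X i) :
    ∃ f : K ⟶ L, Epi (f.f i) ∧ QuasiIsoAt f i := by
  have hK (j : ℤ) : K.d i j = 0 := by
    by_cases h : i + 1 = j
    · exact (K.isZero_of_isStrictlyLE i j).eq_of_tgt _ _
    · exact K.shape _ _ h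
  have h₁ : IsIso (K.homologyι i) := K.isIso_homologyι i _ rfl (hK _)
  let g : K.opcycles i ⟶ L.X i := inv (K.homologyι i) ≫ e.hom
  let f : K ⟶ L := mkHomToSingle (K.pOpcycles i ≫ g) (by intro j _; simp) ≫
    mkHomFromSingle (𝟙 (L.X i)) (by intro j _; simp [hL])
  have hf : f.f i = K.pOpcycles i ≫ g := by simp [f]
  refine ⟨f, ?_, quasiIsoAt_of_pOpcycles_comp_eq f hK hL hL' g hf⟩
  rw [hf]
  infer_instance

open HomologicalComplex CochainComplex in
theorem exists_isStrictlyGE_hom (K : CochainComplex A ℤ) (a : ℤ) :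
    ∃ (L : CochainComplex A ℤ) (_ : L.IsStrictlyGE a) (f : L ⟶ K),
      ∀ j, a ≤ j → IsIso (f.f j) := by
  let e := ComplexShape.embeddingUpIntLE (a - 1)
  have he : e.HasLift (𝟙 (K.restriction e)) := by
    intro j hj i' hi'
    obtain ⟨k, hk⟩ := e.mem_prev hi'
    exact absurd (by simpa [hk] using hi') (hj.2 k)
  let φ := e.liftExtend _ he
  have hφ (j : ℤ) (hj : j < a) : Mono (φ.f j) := by
    have hj' : e.f (a - 1 - j).toNat = j := by simp [e]; omega
    rw [e.mono_liftExtend_f_iff _ he hj']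
    dsimp
    infer_instance
  let S := ShortComplex.mk (kernel.ι φ) φ (by simp)
  have hS : S.Exact := S.exact_of_f_is_kernel (kernelIsKernel φ)
  have hS' (j : ℤ) : (S.map (eval A _ j)).Exact := hS.map _
  refine ⟨kernel φ, ?_, kernel.ι φ, fun j hj ↦ ?_⟩
  · rw [isStrictlyGE_iff]
    intro j hj
    have : Mono (S.map (eval A _ j)).g := hφ j hj
    have h0 := (hS' j).mono_g_iff.1 this
    exact IsZero.of_mono_eq_zero ((kernel.ι φ).f j) h0
  · have : Epi (S.map (eval A _ j)).f := by
      rw [(hS' j).epi_f_iff]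
      refine IsZero.eq_of_tgt ?_ _ _
      refine isZero_extend_X _ _ _ fun k ↦ ?_
      simp [e]; omega
    have : Epi ((kernel.ι φ).f j) := this
    exact isIso_of_mono_of_epi _

open HomologicalComplex in
theorem quasiIsoAt_of_isIso_f {K L : CochainComplex A ℤ} (f : K ⟶ L) (i : ℤ)
    (h : ∀ j, i - 1 ≤ j → IsIso (f.f j)) : QuasiIsoAt f i := by
  rw [quasiIsoAt_iff' f (i - 1) i (i + 1) (by simp) (by simp)]
  let φ := (shortComplexFunctor' A (ComplexShape.up ℤ) (i - 1) i (i + 1)).map f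
  have : IsIso φ.τ₁ := h (i - 1) (by omega)
  have : IsIso φ.τ₂ := h i (by omega)
  have : IsIso φ.τ₃ := h (i + 1) (by omega)
  change ShortComplex.QuasiIso φ
  apply ShortComplex.quasiIso_of_epi_of_isIso_of_mono

theorem hasCoproduct_of_isZero {β : Type*} (X : β → A) (F : Finset β)
    (hF : ∀ b, b ∉ F → IsZero (X b)) : HasCoproduct X := by
  classical
  have := Abelian.hasFiniteBiproducts (C := A)
  let c : Cofan X := Cofan.mk (⨁ fun b : F ↦ X b)
    fun b ↦ if h : b ∈ F then biproduct.ι (fun b : F ↦ X b) ⟨b, h⟩ else 0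
  refine ⟨⟨⟨c, Cofan.IsColimit.mk _ (fun s ↦ biproduct.desc fun b : F ↦ s.inj b) ?_ ?_⟩⟩⟩
  · intro s b
    by_cases h : b ∈ F
    · simp [c, h]
    · exact (hF b h).eq_of_src _ _
  · intro s m hm
    apply biproduct.hom_ext'
    rintro ⟨b, h⟩
    simpa [c, h] using hm b

open HomologicalComplex in
theorem homologyMap_congr_of_f_eq {K L : CochainComplex A ℤ} {f g : K ⟶ L} {i : ℤ}
    (h : f.f i = g.f i) : homologyMap f i = homologyMap g i := by
  have : cyclesMap f i = cyclesMap g i := by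
    rw [← cancel_mono (L.iCycles i), cyclesMap_i, cyclesMap_i, h]
  rw [← cancel_epi (K.homologyπ i), homologyπ_naturality, homologyπ_naturality, this]

open HomologicalComplex in
theorem hasColimit_functor_comp_eval {β : Type*} (E : β → CochainComplex A ℤ) (m : ℤ)
    (F : Finset β) (hF : ∀ b, b ∉ F → IsZero ((E b).X m)) :
    HasColimit (Discrete.functor E ⋙ eval A (ComplexShape.up ℤ) m) :=
  have := hasCoproduct_of_isZero (fun b ↦ (E b).X m) F hF
  hasColimit_of_iso (F := Discrete.functor fun b ↦ (E b).X m)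
    (Discrete.natIso fun _ ↦ Iso.refl _)

open HomologicalComplex in
theorem hasCoproduct_cochainComplex {β : Type*} (E : β → CochainComplex A ℤ)
    (F : ℤ → Finset β) (hF : ∀ m b, b ∉ F m → IsZero ((E b).X m)) : HasCoproduct E := by
  have (m : ℤ) : HasColimit (Discrete.functor E ⋙ eval A (ComplexShape.up ℤ) m) :=
    hasColimit_functor_comp_eval E m (F m) (hF m)
  infer_instance

open HomologicalComplex in
theorem quasiIsoAt_sigma_ι {β : Type*} (E : β → CochainComplex A ℤ)
    (F : ℤ → Finset β) (hF : ∀ m b, b ∉ F m → IsZero ((E b).X m)) [HasCoproduct E] (m : ℤ) (b : β)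
    (hb : ∀ b', b' ≠ b → IsZero ((E b').homology m)) : QuasiIsoAt (Sigma.ι E b) m := by
  classical
  have (m : ℤ) : HasColimit (Discrete.functor E ⋙ eval A (ComplexShape.up ℤ) m) :=
    hasColimit_functor_comp_eval E m (F m) (hF m)
  let G := insert b (F m)
  let φ : ∐ E ⟶ ∐ E := ∑ b' ∈ G, Sigma.π E b' ≫ Sigma.ι E b'
  have hφ : φ.f m = (𝟙 (∐ E) : ∐ E ⟶ ∐ E).f m := by
    refine (isColimitOfPreserves (eval A (ComplexShape.up ℤ) m)
      (coproductIsCoproduct E)).hom_ext ?_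
    rintro ⟨b'⟩
    change (Sigma.ι E b').f m ≫ φ.f m = (Sigma.ι E b').f m ≫ _
    by_cases hb' : b' ∈ G
    · rw [← comp_f, ← comp_f]
      congr 1
      simp only [φ, Preadditive.comp_sum]
      rw [Finset.sum_eq_single b' _ (by simp [hb'])]
      · simp
      · intro b'' _ h
        rw [Sigma.ι_π_of_ne_assoc E h.symm, zero_comp]
    · refine (hF m b' fun h ↦ hb' ?_).eq_of_src _ _
      exact Finset.mem_insert_of_mem h
  have h₁ : homologyMap (Sigma.π E b) m ≫ homologyMap (Sigma.ι E b) m = 𝟙 _ := by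
    rw [← homologyMap_id, ← homologyMap_congr_of_f_eq hφ, ← homologyMap_comp]
    change _ = (homologyFunctor A (ComplexShape.up ℤ) m).map φ
    rw [Functor.map_sum, Finset.sum_eq_single b]
    · rfl
    · intro b' _ h
      rw [Functor.map_comp]
      exact (congrArg (· ≫ _) ((hb b' h).eq_zero_of_tgt _)).trans zero_comp
    · simp [G]
  have h₂ : homologyMap (Sigma.ι E b) m ≫ homologyMap (Sigma.π E b) m = 𝟙 _ := by
    rw [← homologyMap_comp, Sigma.ι_π_eq_id, homologyMap_id]
  rw [quasiIsoAt_iff_isIso_homologyMap]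
  exact ⟨_, h₂, h₁⟩

section

variable [HasDerivedCategory.{w} A]

open DerivedCategory in
theorem singleFunctor_hom_eq_zero (n : ℕ)
    (hgl : ∀ (X Y : A)
      (f : (singleFunctor A 0).obj X ⟶ ((singleFunctor A 0).obj Y)⟦(n + 1 : ℤ)⟧), f = 0)
    (X Y : A) (i : ℤ)
    (f : (singleFunctor A i).obj X ⟶ ((singleFunctor A (i - n)).obj Y)⟦(1 : ℤ)⟧) : f = 0 := by
  let e₁ := ((singleFunctors A).shiftIso i 0 i (by simp)).app X
  let e₂ := (shiftFunctorAdd' (DerivedCategory A) 1 i (1 + i) rfl).app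
    ((singleFunctor A (i - n)).obj Y)
  let e₃ := ((singleFunctors A).shiftIso (1 + i) (-n - 1) (i - n) (by ring)).app Y
  let e₄ := ((singleFunctors A).shiftIso (n + 1 : ℤ) (-n - 1) 0 (by ring)).app Y
  have h := hgl X Y (e₁.inv ≫ f⟦i⟧' ≫ e₂.inv ≫ e₃.hom ≫ e₄.inv)
  apply (shiftFunctor (DerivedCategory A) i).map_injective
  rw [Functor.map_zero, ← cancel_epi e₁.inv, ← cancel_mono (e₂.inv ≫ e₃.hom ≫ e₄.inv)]
  simpa using h

open HomologicalComplex DerivedCategory CochainComplex in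
theorem exists_isStrictlyGE_isStrictlyLE_hom_quasiIsoAt (n : ℕ)
    (hgl : ∀ (X Y : A)
      (f : (DerivedCategory.singleFunctor A 0).obj X ⟶
        ((DerivedCategory.singleFunctor A 0).obj Y)⟦(n + 1 : ℤ)⟧), f = 0)
    (K : CochainComplex A ℤ) (i : ℤ)
    (hK : ∀ j, i - n < j → j < i → IsZero (K.homology j)) :
    ∃ (E : CochainComplex A ℤ) (_ : E.IsStrictlyGE (i - n)) (_ : E.IsStrictlyLE i) (f : E ⟶ K),
      QuasiIsoAt f i ∧ ∀ j, j ≠ i → IsZero (E.homology j) := by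
  let T := K.truncLE i
  have hT (j : ℤ) (h : i - n < j) (h' : j < i) : IsZero (T.homology j) :=
    have := K.quasiIsoAt_ιTruncLE i j h'.le
    (hK j h h').of_iso (asIso (homologyMap (K.ιTruncLE i) j))
  obtain ⟨L, _, g, hg⟩ := exists_isStrictlyGE_hom T (i - n)
  have hgq (j : ℤ) (hj : i - n < j) : QuasiIsoAt g j :=
    quasiIsoAt_of_isIso_f g j fun k hk ↦ hg k (by omega)
  let H : CochainComplex A ℤ := (single A (ComplexShape.up ℤ) i).obj (T.homology i)
  obtain ⟨p, _, _⟩ := exists_epi_quasiIsoAt_of_isStrictlyLE T H i (by simp [H]) (by simp [H])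
    (singleObjXSelf (ComplexShape.up ℤ) i _).symm
  let q : L ⟶ H := g ≫ p
  have hq : Epi q := by
    have (j : ℤ) : Epi (q.f j) := by
      by_cases hj : j = i
      · subst hj
        have := hg j (by omega)
        exact epi_comp (g.f j) (p.f j)
      · exact ⟨fun _ _ _ ↦ (isZero_single_obj_X _ _ _ _ hj).eq_of_src _ _⟩
    exact epi_of_epi_f q this
  let S := ShortComplex.mk (kernel.ι q) q (by simp)
  have hS : S.ShortExact :=
    { exact := S.exact_of_f_is_kernel (kernelIsKernel q)
      mono_f := inferInstanceAs (Mono (kernel.ι q))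
      epi_g := hq }
  have : S.X₁.IsStrictlyGE (i - n) := by
    rw [isStrictlyGE_iff]
    intro j hj
    exact (L.isZero_of_isStrictlyGE (i - n) j).of_mono ((kernel.ι q).f j)
  have : S.X₁.IsLE (i - n) := by
    rw [CochainComplex.isLE_iff]
    intro j hj
    by_cases hij : i < j
    · have := hg j hj.le
      have h : IsZero (S.X₁.X j) :=
        (((T.isZero_of_isStrictlyLE i j).of_iso (asIso (g.f j))).of_mono ((kernel.ι q).f j))
      exact ShortComplex.exact_of_isZero_X₂ _ h
    rw [exactAt_iff_isZero_homology]
    have h₁ : Mono (homologyMap S.f j) :=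
      (hS.homology_exact₁ (j - 1) j (by simp)).mono_g
        ((isZero_single_obj_homology _ i _ (j - 1) (by omega)).eq_of_src _ _)
    have h₂ : Mono (homologyMap S.g j) := by
      have := hgq j hj
      by_cases hj' : j = i
      · subst hj'
        have : QuasiIsoAt S.g j := inferInstanceAs (QuasiIsoAt (g ≫ p) j)
        infer_instance
      · have h : IsZero (L.homology j) :=
          (hT j hj (by omega)).of_iso (asIso (homologyMap g j))
        exact ⟨fun _ _ _ ↦ h.eq_of_tgt _ _⟩
    exact IsZero.of_mono_eq_zero _ ((hS.homology_exact₂ j).mono_g_iff.1 h₂)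
  obtain ⟨Y, ⟨e⟩⟩ := exists_iso_singleFunctor_obj_of_isGE_of_isLE (Q.obj S.X₁) (i - n)
  have hδ : triangleOfSESδ hS = 0 := by
    rw [← cancel_mono (e.hom⟦(1 : ℤ)⟧'), zero_comp]
    exact singleFunctor_hom_eq_zero n hgl _ Y i _
  obtain ⟨σ, hσ⟩ := Pretriangulated.Triangle.coyoneda_exact₃ _ (triangleOfSES_distinguished hS)
    (𝟙 (Q.obj H)) (by
      change _ ≫ triangleOfSESδ hS = 0
      rw [hδ, comp_zero])
  have : H.IsStrictlyGE (i - n) := H.isStrictlyGE_of_ge _ i (by omega)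
  obtain ⟨E, hE, hE', s, hs, t, rfl⟩ :=
    right_fac_of_isStrictlyLE_of_isStrictlyGE (X := H) (Y := L) (i - n) i σ
  have hts : Q.map (t ≫ q) = Q.map s := by
    have : 𝟙 (Q.obj H) = (inv (Q.map s) ≫ Q.map t) ≫ Q.map q := hσ
    rw [Category.assoc, ← Q.map_comp, IsIso.eq_inv_comp] at this
    simpa using this.symm
  have hs' : QuasiIso s := by rwa [← isIso_Q_map_iff_quasiIso]
  have : QuasiIso (t ≫ q) := by rwa [← isIso_Q_map_iff_quasiIso, hts]
  refine ⟨E, hE, hE', t ≫ g ≫ K.ιTruncLE i, ?_, fun j hj ↦ ?_⟩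
  · have : QuasiIsoAt ((t ≫ g) ≫ p) i := by
      rw [Category.assoc]
      exact inferInstanceAs (QuasiIsoAt (t ≫ q) i)
    have := quasiIsoAt_of_comp_right (t ≫ g) p i
    rw [← Category.assoc]
    infer_instance
  · exact (isZero_single_obj_homology _ _ _ _ hj).of_iso (asIso (homologyMap s j))

end

/-- **Rouquier, Lemma 7.2.** Let `A` be an abelian category of global dimension `≤ n`
(i.e. `Ext^{n+1}_A(X, Y) = 0` for all objects `X`, `Y`), and let `C` be a cochain complex
of objects of `A` such that `H^i(C) = 0` whenever `n` does not divide `i`. Then `C` is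
quasi-isomorphic to the complex `⊕_i H^{ni}(C)[-ni]`, i.e. they become isomorphic in the
derived category of `A`. -/
theorem quasiIso_splitComplex_of_global_dimension_le
    [HasDerivedCategory.{w} A] (n : ℕ)
    (hgl : ∀ (X Y : A)
      (f : (DerivedCategory.singleFunctor A 0).obj X ⟶
        ((DerivedCategory.singleFunctor A 0).obj Y)⟦(n + 1 : ℤ)⟧), f = 0)
    (C : CochainComplex A ℤ)
    (hC : ∀ i : ℤ, ¬ (n : ℤ) ∣ i → IsZero (C.homology i)) :
    Nonempty (DerivedCategory.Q.obj C ≅ DerivedCategory.Q.obj (splitComplex C n)) := by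
  have key (i : ℤ) : ∃ (E : CochainComplex A ℤ) (_ : E.IsStrictlyGE (i - n))
      (_ : E.IsStrictlyLE i) (f : E ⟶ C),
      QuasiIsoAt f i ∧ ∀ j, j ≠ i → IsZero (E.homology j) := by
    by_cases hi : (n : ℤ) ∣ i
    · refine exists_isStrictlyGE_isStrictlyLE_hom_quasiIsoAt n hgl C i fun j h₁ h₂ ↦ hC j fun h ↦ ?_
      have := Int.le_of_dvd (by omega) (dvd_sub hi h)
      omega
    · have h0 (j : ℤ) : IsZero ((0 : CochainComplex A ℤ).homology j) :=
        (HomologicalComplex.homologyFunctor A _ j).map_isZero (isZero_zero _)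
      have hX (j : ℤ) : IsZero ((0 : CochainComplex A ℤ).X j) :=
        (HomologicalComplex.eval A _ j).map_isZero (isZero_zero _)
      refine ⟨0, (CochainComplex.isStrictlyGE_iff _ _).2 fun j _ ↦ hX j,
        (CochainComplex.isStrictlyLE_iff _ _).2 fun j _ ↦ hX j, 0, ?_, fun j _ ↦ h0 j⟩
      rw [quasiIsoAt_iff_isIso_homologyMap]
      exact (h0 i).isIso (hC i hi) _
  choose E hGE hLE f hf hE using key
  have hS (i j : ℤ) : (splitComplex C n).d i j = 0 := rfl
  have hS' (i : ℤ) : Nonempty (C.homology i ≅ (splitComplex C n).X i) := by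
    by_cases hi : (n : ℤ) ∣ i
    · exact ⟨eqToIso (if_pos hi).symm⟩
    · exact ⟨(hC i hi).iso ((isZero_zero A).of_iso (eqToIso (if_neg hi)))⟩
  have hg (i : ℤ) : ∃ g : E i ⟶ splitComplex C n, QuasiIsoAt g i := by
    obtain ⟨e⟩ := hS' i
    obtain ⟨g, -, hg⟩ := exists_epi_quasiIsoAt_of_isStrictlyLE (E i) (splitComplex C n) i
      (hS i) (fun j ↦ hS j i) (asIso (HomologicalComplex.homologyMap (f i) i) ≪≫ e)
    exact ⟨g, hg⟩
  choose g hg using hg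
  have hF (m i : ℤ) (hi : i ∉ Finset.Icc m (m + n)) : IsZero ((E i).X m) := by
    rw [Finset.mem_Icc] at hi
    by_cases h : m ≤ i
    · exact (E i).isZero_of_isStrictlyGE (i - n) m
    · exact (E i).isZero_of_isStrictlyLE i m
  have := hasCoproduct_cochainComplex E _ hF
  have hι (m : ℤ) : QuasiIsoAt (Sigma.ι E m) m :=
    quasiIsoAt_sigma_ι E _ hF m m fun i hi ↦ hE i m hi.symm
  have hdesc {K : CochainComplex A ℤ} (h : ∀ i, E i ⟶ K) (hh : ∀ i, QuasiIsoAt (h i) i) :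
      IsIso (DerivedCategory.Q.map (Sigma.desc h)) := by
    rw [DerivedCategory.isIso_Q_map_iff_quasiIso, quasiIso_iff]
    intro m
    have : QuasiIsoAt (Sigma.ι E m ≫ Sigma.desc h) m := by
      rw [Sigma.ι_desc]
      exact hh m
    exact quasiIsoAt_of_comp_left (Sigma.ι E m) _ m
  have := hdesc f hf
  have := hdesc g hg
  exact ⟨(asIso (DerivedCategory.Q.map (Sigma.desc f))).symm ≪≫
    asIso (DerivedCategory.Q.map (Sigma.desc g))⟩

end Rouquier
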